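/- arXiv:2302.05389 — 2 statements merged into one kernel-verified Lean document; each statement's English description precedes it below -/
import Mathlib

section
/- Let (f₀, x₀) be an extremal pair for γ and let μ be any Borel measure on K satisfying ⟨γ(f)x₀, x₀⟩ = ∫_K f(z) dμ(z) for all f ∈ A. Then (‖γ‖² − 1)·∫_K f₀(z) dμ(z) = 0; in particular, if ‖γ‖ > 1 then ∫_K f₀ dμ = 0. -/
open scoped InnerProductSpace

/-- The Möbius estimate `‖z - a‖ ≤ ‖1 - conj a * z‖` on the closed unit disc. -/
lemma Complex.norm_sub_le_norm_one_sub_conj_mul {a z : ℂ} (ha : ‖a‖ ≤ 1) (hz : ‖z‖ ≤ 1) :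
    ‖z - a‖ ≤ ‖1 - (starRingEnd ℂ) a * z‖ := by
  refine (sq_le_sq₀ (norm_nonneg _) (norm_nonneg _)).1 ?_
  have h1 : ‖a‖ ^ 2 ≤ 1 := pow_le_one₀ (norm_nonneg _) ha
  have h2 : ‖z‖ ^ 2 ≤ 1 := pow_le_one₀ (norm_nonneg _) hz
  rw [Complex.sq_norm, Complex.normSq_apply] at *
  rw [Complex.sq_norm, Complex.normSq_apply] at *
  simp only [Complex.sub_re, Complex.sub_im, Complex.mul_re, Complex.mul_im, Complex.conj_re,
    Complex.conj_im, Complex.one_re, Complex.one_im]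
  nlinarith [mul_nonneg (sub_nonneg.2 h1) (sub_nonneg.2 h2)]

/-- A von Neumann type inequality: composing `f` in the unit ball of a uniform algebra with a disc
automorphism stays in the unit ball, so a bounded homomorphism satisfies this estimate. -/
lemma norm_map_mobius_le {K : Type*} [TopologicalSpace K] [CompactSpace K]
    {A : Subalgebra ℂ C(K, ℂ)} (hA : IsClosed (A : Set C(K, ℂ)))
    {H : Type*} [NormedAddCommGroup H] [NormedSpace ℂ H]
    (γ : ↥A →L[ℂ] (H →L[ℂ] H))
    (hmul : ∀ f g : ↥A, γ (f * g) = γ f * γ g) (hone : γ 1 = 1)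
    {f : ↥A} (hf : ‖f‖ ≤ 1) {a : ℂ} (ha : ‖a‖ < 1) (x : H) :
    ‖γ f x - a • x‖ ≤ ‖γ‖ * ‖x - (starRingEnd ℂ) a • γ f x‖ := by
  have : CompleteSpace ↥A := hA.completeSpace_coe
  have hlt : ‖(starRingEnd ℂ) a • f‖ < 1 := by
    rw [norm_smul, RCLike.norm_conj]
    exact (mul_le_of_le_one_right (norm_nonneg _) hf).trans_lt ha
  obtain ⟨u, hu⟩ := isUnit_one_sub_of_norm_lt_one hlt
  set g : ↥A := (f - a • 1) * ↑u⁻¹ with hg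
  have hgu : g * (1 - (starRingEnd ℂ) a • f) = f - a • 1 := by
    rw [← hu, hg, Units.inv_mul_cancel_right]
  have hgn : ‖g‖ ≤ 1 := by
    refine (ContinuousMap.norm_le (g : C(K, ℂ)) zero_le_one).2 fun z => ?_
    have hz : ‖(f : C(K, ℂ)) z‖ ≤ 1 := ((f : C(K, ℂ)).norm_coe_le_norm z).trans hf
    have h1 : (g : C(K, ℂ)) z * (1 - (starRingEnd ℂ) a * (f : C(K, ℂ)) z)
        = (f : C(K, ℂ)) z - a := by
      simpa using congrArg (fun h : ↥A => (h : C(K, ℂ)) z) hgu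
    have hpos : 0 < ‖1 - (starRingEnd ℂ) a * (f : C(K, ℂ)) z‖ := by
      refine norm_pos_iff.2 fun h0 => ?_
      have h2 : ‖(starRingEnd ℂ) a * (f : C(K, ℂ)) z‖ = 1 := by
        rw [← sub_eq_zero.1 h0, norm_one]
      rw [norm_mul, RCLike.norm_conj] at h2
      exact ((mul_le_of_le_one_right (norm_nonneg a) hz).trans_lt ha).ne h2
    have h3 := Complex.norm_sub_le_norm_one_sub_conj_mul ha.le hz
    rw [← h1, norm_mul] at h3
    exact le_of_mul_le_mul_right (by simpa using h3) hpos
  have happ : γ g (x - (starRingEnd ℂ) a • γ f x) = γ f x - a • x := by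
    have h := congrArg (fun T : H →L[ℂ] H => T x) (congrArg γ hgu)
    rw [hmul] at h
    simpa [hone] using h
  rw [← happ]
  refine (γ g).le_of_opNorm_le ?_ _
  exact (γ.le_opNorm g).trans (mul_le_of_le_one_right (norm_nonneg _) hgn)

/-- An extremal vector is orthogonal to its image when the homomorphism is not contractive. -/
lemma inner_map_extremal_eq_zero {K : Type*} [TopologicalSpace K] [CompactSpace K]
    {A : Subalgebra ℂ C(K, ℂ)} (hA : IsClosed (A : Set C(K, ℂ)))
    {H : Type*} [NormedAddCommGroup H] [InnerProductSpace ℂ H]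
    (γ : ↥A →L[ℂ] (H →L[ℂ] H))
    (hmul : ∀ f g : ↥A, γ (f * g) = γ f * γ g) (hone : γ 1 = 1)
    {f : ↥A} {x : H} (hf : ‖f‖ ≤ 1) (hx : ‖x‖ = 1) (hext : ‖γ f x‖ = ‖γ‖) (hγ : 1 < ‖γ‖) :
    ⟪x, γ f x⟫_ℂ = 0 := by
  by_contra hw
  set w := ⟪x, γ f x⟫_ℂ with hw_def
  set C := ‖γ‖
  have hs : 0 < ‖w‖ := norm_pos_iff.2 hw
  have hwC : ‖w‖ ≤ C := by
    simpa [hx, hext] using norm_inner_le_norm (𝕜 := ℂ) x (γ f x)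
  have hD : 0 < C ^ 2 + 1 := by positivity
  set t : ℝ := (C ^ 2 + 1)⁻¹ with ht
  have htpos : 0 < t := inv_pos.2 hD
  have htD : t * (C ^ 2 + 1) = 1 := inv_mul_cancel₀ hD.ne'
  have hna : ‖(t : ℂ) * w‖ = t * ‖w‖ := by
    rw [norm_mul, Complex.norm_real, Real.norm_of_nonneg htpos.le]
  have ha : ‖(t : ℂ) * w‖ < 1 := by
    rw [hna]
    calc t * ‖w‖ ≤ t * C := by gcongr
      _ < t * (C ^ 2 + 1) := by gcongr; nlinarith
      _ = 1 := htD
  have h := pow_le_pow_left₀ (norm_nonneg _) (norm_map_mobius_le hA γ hmul hone hf ha x) 2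
  have hww : (w * (starRingEnd ℂ) w).re = ‖w‖ ^ 2 := by
    rw [Complex.mul_conj, Complex.ofReal_re, Complex.sq_norm]
  have hr1 : (⟪γ f x, ((t : ℂ) * w) • x⟫_ℂ).re = t * ‖w‖ ^ 2 := by
    rw [inner_smul_right, ← inner_conj_symm, ← hw_def, mul_assoc, Complex.re_ofReal_mul, hww]
  have hr2 : (⟪x, (starRingEnd ℂ) ((t : ℂ) * w) • γ f x⟫_ℂ).re = t * ‖w‖ ^ 2 := by
    rw [inner_smul_right, ← hw_def, map_mul, Complex.conj_ofReal, mul_assoc,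
      Complex.re_ofReal_mul, mul_comm _ w, hww]
  rw [mul_pow, norm_sub_sq (𝕜 := ℂ), norm_sub_sq (𝕜 := ℂ)] at h
  simp only [RCLike.re_to_complex] at h
  rw [hr1, hr2, norm_smul, norm_smul, RCLike.norm_conj, hna, hx, hext] at h
  have hpos : 0 < t * ‖w‖ ^ 2 * (C ^ 2 - 1) :=
    mul_pos (by positivity) (by nlinarith)
  have hkey : t * ‖w‖ ^ 2 * (C ^ 2 - 1) * 2
      ≤ t * ‖w‖ ^ 2 * (C ^ 2 - 1) * (t * (C ^ 2 + 1)) := by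
    linear_combination h
  rw [htD] at hkey
  linarith

/-- **Proposition (orthogonality relation for extremal measures).**
If `(f₀, x₀)` is an extremal pair for `γ` and `μ` is an extremal measure for
`(f₀, x₀)`, i.e. `⟨γ(f)x₀, x₀⟩ = ∫_K f dμ` for all `f ∈ A`, then
`(‖γ‖² − 1) ∫_K f₀ dμ = 0`; in particular if `‖γ‖ > 1` then `∫_K f₀ dμ = 0`. -/
theorem stmt_4 {K : Type*} [TopologicalSpace K] [CompactSpace K] [T2Space K]
    [MeasurableSpace K] [BorelSpace K]
    (A : Subalgebra ℂ C(K, ℂ)) (hA : IsClosed (A : Set C(K, ℂ)))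
    {H : Type*} [NormedAddCommGroup H] [InnerProductSpace ℂ H]
    (γ : ↥A →L[ℂ] (H →L[ℂ] H))
    (hmul : ∀ f g : ↥A, γ (f * g) = γ f * γ g) (hone : γ 1 = 1)
    (f₀ : ↥A) (x₀ : H) (hf₀ : ‖f₀‖ = 1) (hx₀ : ‖x₀‖ = 1)
    (hext : ‖γ f₀ x₀‖ = ‖γ‖)
    (μ : MeasureTheory.Measure K)
    (hμ : ∀ f : ↥A, ⟪x₀, γ f x₀⟫_ℂ = ∫ z, (f : C(K, ℂ)) z ∂μ) :
    ((‖γ‖ : ℂ) ^ 2 - 1) * ∫ z, (f₀ : C(K, ℂ)) z ∂μ = 0 ∧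
      (1 < ‖γ‖ → ∫ z, (f₀ : C(K, ℂ)) z ∂μ = 0) := by
  have h0 : 1 < ‖γ‖ → ∫ z, (f₀ : C(K, ℂ)) z ∂μ = 0 := fun h => by
    rw [← hμ]
    exact inner_map_extremal_eq_zero hA γ hmul hone hf₀.le hx₀ hext h
  refine ⟨?_, h0⟩
  have hC : 1 ≤ ‖γ‖ := by
    have h1 : ‖(1 : ↥A)‖ ≤ 1 :=
      (ContinuousMap.norm_le (1 : C(K, ℂ)) zero_le_one).2 fun z => by simp
    calc (1 : ℝ) = ‖γ 1 x₀‖ := by simp [hone, hx₀]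
      _ ≤ ‖γ 1‖ * ‖x₀‖ := (γ 1).le_opNorm x₀
      _ = ‖γ 1‖ := by rw [hx₀, mul_one]
      _ ≤ ‖γ‖ * ‖(1 : ↥A)‖ := γ.le_opNorm 1
      _ ≤ ‖γ‖ := mul_le_of_le_one_right γ.opNorm_nonneg h1
  rcases hC.eq_or_lt with h | h
  · simp [← h]
  · rw [h0 h, mul_zero]
end

section
/- Suppose ‖γ‖ > 1 and γ admits an extremal pair. Then for every bounded conjugate-linear map Φ : A → A and every bounded linear functional ω on A, ‖γ‖ ≤ ‖γ_Φ − ω‖ + √( ‖γ_Φ − ω‖² + ‖Φ‖ + ‖ω‖ ). -/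
open scoped InnerProductSpace

open ContinuousLinearMap in
/-- A unit vector at which a bound `c` for the norm of `T` is attained is an eigenvector of `T* T`. -/
theorem adjoint_apply_apply_eq_of_norm_attained {H : Type*} [NormedAddCommGroup H]
    [InnerProductSpace ℂ H] [CompleteSpace H] {T : H →L[ℂ] H} {x : H} {c : ℝ}
    (hT : ‖T‖ ≤ c) (hx : ‖x‖ = 1) (hTx : ‖T x‖ = c) :
    adjoint T (T x) = ((c ^ 2 : ℝ) : ℂ) • x := by
  have hc : 0 ≤ c := hTx ▸ norm_nonneg _
  have h1 : ‖adjoint T (T x)‖ ≤ c * c := by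
    refine (le_opNorm _ _).trans ?_
    rw [LinearIsometryEquiv.norm_map, hTx]
    gcongr
  have h2 : RCLike.re (inner ℂ (adjoint T (T x)) (((c ^ 2 : ℝ) : ℂ) • x)) = c ^ 2 * c ^ 2 := by
    rw [inner_smul_right, adjoint_inner_left, inner_self_eq_norm_sq_to_K, hTx]
    norm_cast
    exact (congrArg Complex.re (Complex.ofReal_mul _ _).symm).trans (Complex.ofReal_re _)
  have h3 : ‖((c ^ 2 : ℝ) : ℂ) • x‖ = c ^ 2 := by
    rw [norm_smul, hx, mul_one, Complex.norm_real, Real.norm_of_nonneg (sq_nonneg c)]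
  have h4 := norm_sub_sq (𝕜 := ℂ) (adjoint T (T x)) (((c ^ 2 : ℝ) : ℂ) • x)
  rw [h2, h3] at h4
  have h5 : ‖adjoint T (T x)‖ ^ 2 ≤ (c * c) ^ 2 := by gcongr
  have h6 : ‖adjoint T (T x) - ((c ^ 2 : ℝ) : ℂ) • x‖ ^ 2 ≤ 0 := by nlinarith
  exact sub_eq_zero.mp (norm_eq_zero.mp (pow_eq_zero_iff two_ne_zero |>.mp
    (le_antisymm h6 (sq_nonneg _))))

/-- The vector state of an extremal vector is contractive along a bounded homomorphism. -/
theorem norm_inner_apply_le_of_extremal {A H : Type*} [SeminormedRing A] [NormedAlgebra ℂ A]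
    [NormedAddCommGroup H] [InnerProductSpace ℂ H] [CompleteSpace H]
    {γ : A →L[ℂ] (H →L[ℂ] H)} (hmul : ∀ f g : A, γ (f * g) = γ f * γ g) (hγ : 0 < ‖γ‖)
    {f₀ : A} {x₀ : H} (hf₀ : ‖f₀‖ = 1) (hx₀ : ‖x₀‖ = 1) (hext : ‖γ f₀ x₀‖ = ‖γ‖) (f : A) :
    ‖⟪x₀, γ f x₀⟫_ℂ‖ ≤ ‖f‖ := by
  have hT : ‖γ f₀‖ ≤ ‖γ‖ := by simpa [hf₀] using γ.le_opNorm f₀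
  have key : ⟪γ f₀ x₀, γ (f₀ * f) x₀⟫_ℂ = ((‖γ‖ ^ 2 : ℝ) : ℂ) * ⟪x₀, γ f x₀⟫_ℂ := by
    rw [hmul, mul_apply_eq_comp, ← ContinuousLinearMap.adjoint_inner_left,
      adjoint_apply_apply_eq_of_norm_attained hT hx₀ hext, inner_smul_left, Complex.conj_ofReal]
  have hbound : ‖⟪γ f₀ x₀, γ (f₀ * f) x₀⟫_ℂ‖ ≤ ‖γ‖ ^ 2 * ‖f‖ :=
    calc ‖⟪γ f₀ x₀, γ (f₀ * f) x₀⟫_ℂ‖ ≤ ‖γ f₀ x₀‖ * ‖γ (f₀ * f) x₀‖ := norm_inner_le_norm _ _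
      _ ≤ ‖γ‖ * (‖γ (f₀ * f)‖ * ‖x₀‖) := by
        rw [hext]; gcongr; exact ContinuousLinearMap.le_opNorm _ _
      _ ≤ ‖γ‖ * (‖γ‖ * (‖f₀‖ * ‖f‖)) := by
        rw [hx₀, mul_one]; gcongr
        exact (γ.le_opNorm _).trans (by gcongr; exact norm_mul_le _ _)
      _ = ‖γ‖ ^ 2 * ‖f‖ := by rw [hf₀]; ring
  rw [key, norm_mul, Complex.norm_real, Real.norm_of_nonneg (sq_nonneg _)] at hbound
  exact le_of_mul_le_mul_left hbound (by positivity)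

/-- **Corollary (Crouzeix–Greenbaum type bound).** Let `γ : A → L(H)` be a
unital bounded homomorphism with `‖γ‖ > 1` admitting an extremal pair. Then for
every bounded antilinear map `Φ : A → A`, with `γ_Φ(f) = γ(f) + γ(Φ(f))*`, and
every bounded linear functional `ω` on `A`,
`‖γ‖ ≤ ‖γ_Φ − ω‖ + √(‖γ_Φ − ω‖² + ‖Φ‖ + ‖ω‖)`. -/
theorem stmt_7 {K : Type*} [TopologicalSpace K] [CompactSpace K] [T2Space K]
    (A : Subalgebra ℂ C(K, ℂ)) (hA : IsClosed (A : Set C(K, ℂ)))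
    {H : Type*} [NormedAddCommGroup H] [InnerProductSpace ℂ H] [CompleteSpace H]
    (γ : ↥A →L[ℂ] (H →L[ℂ] H))
    (hmul : ∀ f g : ↥A, γ (f * g) = γ f * γ g) (hone : γ 1 = 1)
    (hγ : 1 < ‖γ‖)
    (hextremal : ∃ (f₀ : ↥A) (x₀ : H), ‖f₀‖ = 1 ∧ ‖x₀‖ = 1 ∧ ‖γ f₀ x₀‖ = ‖γ‖) :
    ∀ (Φ : ↥A →SL[starRingEnd ℂ] ↥A) (γΦ : ↥A →L[ℂ] (H →L[ℂ] H)),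
      (∀ f : ↥A, γΦ f = γ f + ContinuousLinearMap.adjoint (γ (Φ f))) →
      ∀ ω : ↥A →L[ℂ] ℂ,
        ‖γ‖ ≤ ‖γΦ - ω.smulRight (1 : H →L[ℂ] H)‖ +
          Real.sqrt (‖γΦ - ω.smulRight (1 : H →L[ℂ] H)‖ ^ 2 + ‖Φ‖ + ‖ω‖) := by
  obtain ⟨f₀, x₀, hf₀, hx₀, hext⟩ := hextremal
  intro Φ γΦ hγΦ ω
  have hγ0 : 0 < ‖γ‖ := one_pos.trans hγ
  have hstate := norm_inner_apply_le_of_extremal hmul hγ0 hf₀ hx₀ hext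
  set S := γΦ - ω.smulRight (1 : H →L[ℂ] H) with hS
  have hexpand : ⟪S f₀ x₀, γ f₀ x₀⟫_ℂ = ((‖γ‖ ^ 2 : ℝ) : ℂ) + ⟪x₀, γ (Φ f₀ * f₀) x₀⟫_ℂ
      - starRingEnd ℂ (ω f₀) * ⟪x₀, γ f₀ x₀⟫_ℂ := by
    have : S f₀ x₀ = γ f₀ x₀ + ContinuousLinearMap.adjoint (γ (Φ f₀)) x₀ - ω f₀ • x₀ := by
      simp [hS, hγΦ]
    rw [this, inner_sub_left, inner_add_left, ContinuousLinearMap.adjoint_inner_left,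
      inner_smul_left, hmul, mul_apply_eq_comp, inner_self_eq_norm_sq_to_K, hext]
    norm_cast
  have hSnorm : ‖⟪S f₀ x₀, γ f₀ x₀⟫_ℂ‖ ≤ ‖S‖ * ‖γ‖ := by
    refine (norm_inner_le_norm _ _).trans ?_
    rw [hext]
    gcongr
    refine ((S f₀).le_opNorm x₀).trans ?_
    rw [hx₀, mul_one]
    exact (S.le_opNorm f₀).trans_eq (by rw [hf₀, mul_one])
  have hΦ : ‖⟪x₀, γ (Φ f₀ * f₀) x₀⟫_ℂ‖ ≤ ‖Φ‖ := by
    refine (hstate _).trans ((norm_mul_le _ _).trans ?_)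
    rw [hf₀, mul_one]
    exact (Φ.le_opNorm f₀).trans_eq (by rw [hf₀, mul_one])
  have hω : ‖starRingEnd ℂ (ω f₀) * ⟪x₀, γ f₀ x₀⟫_ℂ‖ ≤ ‖ω‖ := by
    rw [norm_mul, RCLike.norm_conj]
    have h1 : ‖ω f₀‖ ≤ ‖ω‖ := (ω.le_opNorm f₀).trans_eq (by rw [hf₀, mul_one])
    have h2 : ‖⟪x₀, γ f₀ x₀⟫_ℂ‖ ≤ 1 := hf₀ ▸ hstate f₀
    exact (mul_le_of_le_one_right (norm_nonneg _) h2).trans h1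
  have hsq : ‖γ‖ ^ 2 ≤ ‖S‖ * ‖γ‖ + ‖Φ‖ + ‖ω‖ := by
    have heq : ((‖γ‖ ^ 2 : ℝ) : ℂ) = ⟪S f₀ x₀, γ f₀ x₀⟫_ℂ - ⟪x₀, γ (Φ f₀ * f₀) x₀⟫_ℂ
        + starRingEnd ℂ (ω f₀) * ⟪x₀, γ f₀ x₀⟫_ℂ := by rw [hexpand]; ring
    calc ‖γ‖ ^ 2 = ‖((‖γ‖ ^ 2 : ℝ) : ℂ)‖ := by
          rw [Complex.norm_real, Real.norm_of_nonneg (sq_nonneg _)]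
      _ ≤ ‖S‖ * ‖γ‖ + ‖Φ‖ + ‖ω‖ := by
          rw [heq]
          exact (norm_add_le _ _).trans (add_le_add ((norm_sub_le _ _).trans
            (add_le_add hSnorm hΦ)) hω)
  rw [← sub_le_iff_le_add']
  apply Real.le_sqrt_of_sq_le
  nlinarith [mul_nonneg (norm_nonneg S) hγ0.le]
end
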